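/- Let $p$ be a prime integer, $k$ a field of $\operatorname{char}(k) = p$, $n \geq 2$, and $F = k((\alpha_1))\dots((\alpha_n))$ the field of iterated Laurent series in $n$ indeterminates over $k$. Then the tensor product of symbol algebras $[\alpha_2^{-1},\alpha_1)_{p,F} \otimes_F [\alpha_3^{-1},\alpha_2)_{p,F} \otimes_F \dots \otimes_F [\alpha_n^{-1},\alpha_{n-1})_{p,F}$ is a division algebra over $F$. -/

import Mathlib

open scoped TensorProduct

noncomputable def IterLaurentAux (k : Type) [Field k] : ℕ → (T : Type) × Field T
  | 0 => ⟨k, inferInstance⟩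
  | n + 1 =>
      letI := (IterLaurentAux k n).2
      ⟨LaurentSeries (IterLaurentAux k n).1, inferInstance⟩

/-- The field of iterated Laurent series `k((α₁))…((αₙ))` in `n` indeterminates over `k`. -/
noncomputable def IterLaurent (k : Type) [Field k] (n : ℕ) : Type :=
  (IterLaurentAux k n).1

noncomputable instance IterLaurent.instField (k : Type) [Field k] (n : ℕ) :
    Field (IterLaurent k n) :=
  (IterLaurentAux k n).2

/-- The indeterminates of `k((α₁))…((αₙ))`: `IterLaurent.var k n i` is `α_{i+1}`
(so `i = 0` gives the innermost variable `α₁` and `i = n-1` the outermost one `αₙ`). -/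
noncomputable def IterLaurent.var (k : Type) [Field k] : ∀ n, Fin n → IterLaurent k n
  | n + 1, i =>
      Fin.lastCases
        (show IterLaurent k (n + 1) from
          (HahnSeries.single (1 : ℤ) (1 : IterLaurent k n) : LaurentSeries (IterLaurent k n)))
        (fun j => show IterLaurent k (n + 1) from
          (HahnSeries.C (IterLaurent.var k n j) : LaurentSeries (IterLaurent k n)))
        i

noncomputable def SymGenX (F : Type) [Field F] : FreeAlgebra F (Fin 2) := FreeAlgebra.ι F 0
noncomputable def SymGenY (F : Type) [Field F] : FreeAlgebra F (Fin 2) := FreeAlgebra.ι F 1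

/-- Relations of the symbol algebra `[a,b)_{p,F}` in characteristic `p`:
`x^p - x = a`, `y^p = b`, `y x = (x + 1) y` (i.e. `y x y⁻¹ = x + 1`). -/
inductive ASSymbolRel (F : Type) [Field F] (p : ℕ) (a b : F) :
    FreeAlgebra F (Fin 2) → FreeAlgebra F (Fin 2) → Prop
  | x : ASSymbolRel F p a b (SymGenX F ^ p - SymGenX F) (algebraMap F _ a)
  | y : ASSymbolRel F p a b (SymGenY F ^ p) (algebraMap F _ b)
  | comm : ASSymbolRel F p a b (SymGenY F * SymGenX F) ((SymGenX F + 1) * SymGenY F)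

/-- The degree-`p` symbol algebra `[a,b)_{p,F} = F⟨x,y : x^p - x = a, y^p = b, yxy⁻¹ = x+1⟩`
in characteristic `p`. -/
noncomputable def ASSymbol (F : Type) [Field F] (p : ℕ) (a b : F) : Type :=
  RingQuot (ASSymbolRel F p a b)

noncomputable instance (F : Type) [Field F] (p : ℕ) (a b : F) : Ring (ASSymbol F p a b) :=
  inferInstanceAs (Ring (RingQuot (ASSymbolRel F p a b)))

noncomputable instance (F : Type) [Field F] (p : ℕ) (a b : F) : Algebra F (ASSymbol F p a b) :=
  inferInstanceAs (Algebra F (RingQuot (ASSymbolRel F p a b)))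

/-- A (possibly noncommutative) ring is a division ring iff it is nontrivial and
every nonzero element is invertible. -/
def IsDivisionAlgebra (D : Type) [Ring D] : Prop :=
  Nontrivial D ∧ ∀ x : D, x ≠ 0 → IsUnit x

/-- The ordered monomial `∏ᵢ xᵢ ^ aᵢ * yᵢ ^ bᵢ`, where `J i = (aᵢ, bᵢ)`. -/
def symbolMonomial {R : Type*} [Monoid R] {m p : ℕ} (x y : Fin m → R)
    (J : Fin m → Fin p × Fin p) : R :=
  (List.ofFn fun i => x i ^ (J i).1.val * y i ^ (J i).2.val).prod

/-- The commutation relations between the generators of a tensor product of symbol algebras. -/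
structure SymbolCommRel {R : Type*} [Ring R] {m : ℕ} (x y : Fin m → R) : Prop where
  mul_eq : ∀ i, y i * x i = (x i + 1) * y i
  isUnit : ∀ i, IsUnit (y i)
  commute_xx : ∀ i j, i ≠ j → Commute (x i) (x j)
  commute_yy : ∀ i j, i ≠ j → Commute (y i) (y j)
  commute_xy : ∀ i j, i ≠ j → Commute (x i) (y j)

theorem symbolMonomial_snoc {R : Type*} [Monoid R] {m p : ℕ} (x y : Fin (m + 1) → R)
    (J : Fin m → Fin p × Fin p) (q : Fin p × Fin p) :
    symbolMonomial x y (Fin.snoc J q : Fin (m + 1) → Fin p × Fin p) =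
      symbolMonomial (fun i => x i.castSucc) (fun i => y i.castSucc) J *
        (x (Fin.last m) ^ q.1.val * y (Fin.last m) ^ q.2.val) := by
  rw [symbolMonomial, symbolMonomial, List.ofFn_succ_last]
  simp

theorem Commute.symbolMonomial_left {R : Type*} [Monoid R] {m p : ℕ} {x y : Fin m → R} {z : R}
    (hx : ∀ i, Commute (x i) z) (hy : ∀ i, Commute (y i) z) (J : Fin m → Fin p × Fin p) :
    Commute (symbolMonomial x y J) z := by
  refine Commute.list_prod_left _ _ fun w hw => ?_
  obtain ⟨i, rfl⟩ := (List.mem_ofFn' _ _).1 hw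
  exact ((hx i).pow_left _).mul_left ((hy i).pow_left _)

theorem sum_snoc {M Q : Type*} [AddCommMonoid M] [Fintype Q] {m : ℕ}
    (f : (Fin (m + 1) → Q) → M) :
    ∑ J, f J = ∑ q : Q, ∑ J : Fin m → Q, f (Fin.snoc J q) := by
  rw [← Fintype.sum_prod_type']
  exact (Fintype.sum_equiv (Fin.snocEquiv fun _ => Q) _ _ fun _ => rfl).symm

/-- Vectors killed in total which are scaled by `0, 1, …, N - 1` under an additive map vanish, in
characteristic at least `N`. -/
theorem eq_zero_of_sum_eq_zero_of_eigen {M : Type*} [AddCommGroup M] {p : ℕ} (hp : p.Prime)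
    (hM : ∀ v : M, p • v = 0) (D : M →+ M) (g : ℕ → M) (hg : ∀ b, D (g b) = b • g b) (N : ℕ)
    (hN : N ≤ p) (h : ∑ b ∈ Finset.range N, g b = 0) : ∀ b < N, g b = 0 := by
  induction N generalizing g with
  | zero => intro b hb; omega
  | succ N ih =>
    have key : ∀ b < N, (N - b) • g b = 0 := by
      refine ih (fun b => (N - b) • g b) (fun b => ?_) (by omega) ?_
      · rw [map_nsmul, hg, smul_comm]
      · have h1 : D (∑ b ∈ Finset.range (N + 1), g b) = 0 := by rw [h, map_zero]
        rw [map_sum, Finset.sum_range_succ] at h1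
        rw [Finset.sum_range_succ] at h
        have h2 : ∑ b ∈ Finset.range N, (N - b) • g b =
            N • ∑ b ∈ Finset.range N, g b - ∑ b ∈ Finset.range N, D (g b) := by
          rw [Finset.smul_sum, ← Finset.sum_sub_distrib]
          refine Finset.sum_congr rfl fun b hb => ?_
          rw [hg, sub_nsmul _ (Finset.mem_range.1 hb).le, sub_eq_add_neg]
        rw [h2, eq_neg_of_add_eq_zero_left h, eq_neg_of_add_eq_zero_left h1, hg]
        simp
    have key' : ∀ b < N, g b = 0 := by
      intro b hb
      have hc : Nat.Coprime (N - b) p :=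
        ((Nat.coprime_of_lt_prime (by omega) (by omega) hp).symm)
      have h3 := addOrderOf_dvd_of_nsmul_eq_zero (key b hb)
      have h4 := addOrderOf_dvd_of_nsmul_eq_zero (hM (g b))
      exact AddMonoid.addOrderOf_eq_one_iff.1 (Nat.eq_one_of_dvd_coprimes hc h3 h4)
    intro b hb
    rcases Nat.lt_succ_iff_lt_or_eq.1 hb with hb | rfl
    · exact key' b hb
    · rw [Finset.sum_range_succ, Finset.sum_eq_zero fun b hb => key' b (Finset.mem_range.1 hb),
        zero_add] at h
      exact h

theorem eq_zero_of_sum_mul_pow_eq_zero {R : Type*} [Ring R] {p : ℕ} (hp : p.Prime) [CharP R p]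
    {x y : R} (hxy : y * x = (x + 1) * y) (hy : IsUnit y) (N : ℕ) (hN : N ≤ p) (d : ℕ → R)
    (hd : ∀ a, Commute (d a) y)
    (h : ∑ a ∈ Finset.range N, d a * x ^ a = 0) : ∀ a < N, d a = 0 := by
  induction N generalizing d with
  | zero => intro b hb; omega
  | succ N ih =>
    have hpow : ∀ a, y * x ^ a = (x + 1) ^ a * y := fun a =>
      (show SemiconjBy y x (x + 1) from hxy).pow_right a
    have h1 : ∑ a ∈ Finset.range (N + 1), d a * (x + 1) ^ a = 0 := by
      refine (hy.mul_left_eq_zero).1 ?_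
      rw [Finset.sum_mul]
      calc _ = ∑ a ∈ Finset.range (N + 1), y * (d a * x ^ a) :=
            Finset.sum_congr rfl fun a _ => by
              rw [mul_assoc, ← hpow, ← mul_assoc, (hd a).eq, mul_assoc]
        _ = 0 := by rw [← Finset.mul_sum, h, mul_zero]
    have h2 : ∑ i ∈ Finset.range N,
        (∑ a ∈ Finset.range (N + 1), if i < a then d a * (a.choose i : R) else 0) * x ^ i = 0 := by
      have h3 : ∀ a ∈ Finset.range (N + 1), d a * (x + 1) ^ a - d a * x ^ a =
          ∑ i ∈ Finset.range N, (if i < a then d a * (a.choose i : R) else 0) * x ^ i := by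
        intro a ha
        rw [(Commute.one_right x).add_pow, Finset.sum_range_succ]
        have : a ≤ N := by simpa [Nat.lt_succ_iff] using ha
        rw [← Finset.sum_subset (Finset.range_mono this)]
        · simp only [one_pow, mul_one, Nat.choose_self, Nat.cast_one, mul_add, add_sub_cancel_right,
            Finset.mul_sum]
          refine Finset.sum_congr rfl fun i hi => ?_
          rw [if_pos (Finset.mem_range.1 hi), mul_assoc, (Nat.cast_commute (a.choose i) _).eq]
        · intro i _ hi
          rw [if_neg (by simpa using hi), zero_mul]
      simp_rw [Finset.sum_mul]
      rw [Finset.sum_comm, ← Finset.sum_congr rfl h3, Finset.sum_sub_distrib, h, h1, sub_zero]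
    have h4 := ih (by omega) _ (fun i => ?_) h2
    · have hdN : d N = 0 := by
        rcases Nat.eq_zero_or_pos N with rfl | hpos
        · simpa using h
        have h5 := h4 (N - 1) (by omega)
        rw [Finset.sum_range_succ, Finset.sum_eq_zero, zero_add, if_pos (by omega)] at h5
        · have hu : IsUnit ((N.choose (N - 1) : ℕ) : R) := by
            rw [CharP.isUnit_natCast_iff hp, Nat.choose_symm_of_eq_add (n := N) (a := N - 1) (b := 1)
                (by omega),
              Nat.choose_one_right]
            exact fun hdvd => absurd (Nat.le_of_dvd hpos hdvd) (by omega)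
          exact (hu.mul_left_eq_zero).1 h5
        · intro a ha
          rw [if_neg]
          have := Finset.mem_range.1 ha
          omega
      rw [Finset.sum_range_succ, hdN, zero_mul, add_zero] at h
      intro a ha
      rcases Nat.lt_succ_iff_lt_or_eq.1 ha with ha | rfl
      · exact ih (by omega) d hd h a ha
      · exact hdN
    · refine Commute.sum_left _ _ _ fun a _ => ?_
      split_ifs
      · exact (hd a).mul_left (Nat.cast_commute _ _)
      · exact Commute.zero_left _

theorem eq_zero_of_sum_mul_pow_mul_pow_eq_zero {R : Type*} [Ring R] {p : ℕ} (hp : p.Prime)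
    [CharP R p] {x y : R} (hxy : y * x = (x + 1) * y) (hy : IsUnit y) (d : Fin p × Fin p → R)
    (hdx : ∀ q, Commute (d q) x) (hdy : ∀ q, Commute (d q) y)
    (h : ∑ q, d q * (x ^ q.1.val * y ^ q.2.val) = 0) : d = 0 := by
  have hy1 : ∀ b : ℕ, y ^ b * x - x * y ^ b = b • y ^ b := by
    intro b
    induction b with
    | zero => simp
    | succ b ih =>
      rw [pow_succ, mul_assoc, hxy, add_mul, one_mul, mul_add, succ_nsmul, ← smul_mul_assoc, ← ih]
      noncomm_ring
  let D : R →+ R := AddMonoidHom.mulRight x - AddMonoidHom.mulLeft x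
  let g : ℕ → R := fun b => ∑ a : Fin p,
    (if hb : b < p then d (a, ⟨b, hb⟩) * (x ^ a.val * y ^ b) else 0)
  have hg : ∀ b, D (g b) = b • g b := by
    intro b
    simp only [g, map_sum, Finset.smul_sum]
    refine Finset.sum_congr rfl fun a _ => ?_
    split_ifs with hb
    · simp only [D, AddMonoidHom.sub_apply, AddMonoidHom.mulRight_apply,
        AddMonoidHom.coe_mulLeft]
      rw [← mul_assoc x, ← (hdx _).eq, mul_assoc (d _) x, ← mul_assoc x, ← pow_succ', pow_succ,
        mul_assoc (d _), mul_assoc, mul_assoc (x ^ _), ← mul_sub, ← mul_sub, hy1, mul_smul_comm,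
        mul_smul_comm]
    · simp
  have hsum : ∑ b ∈ Finset.range p, g b = 0 := by
    rw [Finset.sum_range, ← h, Fintype.sum_prod_type, Finset.sum_comm]
    exact Finset.sum_congr rfl fun b _ => Finset.sum_congr rfl fun a _ => by simp
  have hzero := eq_zero_of_sum_eq_zero_of_eigen hp (fun v => by simp [nsmul_eq_mul]) D g hg p le_rfl
    hsum
  ext ⟨a, b⟩
  have h1 := hzero b b.2
  have h2 : ∑ a ∈ Finset.range p, (if ha : a < p then d (⟨a, ha⟩, b) else 0) * x ^ a = 0 := by
    refine ((hy.pow b.val).mul_left_eq_zero).1 ?_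
    rw [Finset.sum_range, Finset.sum_mul, ← h1]
    exact Finset.sum_congr rfl fun a _ => by simp [mul_assoc]
  have h3 := eq_zero_of_sum_mul_pow_eq_zero hp hxy hy p le_rfl _ (fun a => by
    split_ifs
    · exact hdy _
    · exact Commute.zero_left _) h2 a a.2
  simpa using h3

/-- Ordered monomials are linearly independent over the commutant of the generators. -/
theorem SymbolCommRel.eq_zero_of_sum_eq_zero {R : Type*} [Ring R] {p : ℕ} (hp : p.Prime)
    [CharP R p] {m : ℕ} {x y : Fin m → R} (hxy : SymbolCommRel x y)
    (c : (Fin m → Fin p × Fin p) → R) (hcx : ∀ J i, Commute (c J) (x i))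
    (hcy : ∀ J i, Commute (c J) (y i))
    (h : ∑ J, c J * symbolMonomial x y J = 0) : c = 0 := by
  induction m with
  | zero =>
    ext J
    rw [Fintype.sum_unique] at h
    rw [Subsingleton.elim J default]
    simpa [symbolMonomial] using h
  | succ m ih =>
    rw [sum_snoc] at h
    simp_rw [symbolMonomial_snoc, ← mul_assoc (c _), ← Finset.sum_mul] at h
    have hne : ∀ i : Fin m, i.castSucc ≠ Fin.last m := fun i => (Fin.castSucc_lt_last i).ne
    have h1 := eq_zero_of_sum_mul_pow_mul_pow_eq_zero hp (hxy.mul_eq _) (hxy.isUnit _) _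
      (fun q => Commute.sum_left _ _ _ fun J _ => (hcx _ _).mul_left
        (Commute.symbolMonomial_left (fun i => hxy.commute_xx _ _ (hne i))
          (fun i => (hxy.commute_xy _ _ (hne i).symm).symm) J))
      (fun q => Commute.sum_left _ _ _ fun J _ => (hcy _ _).mul_left
        (Commute.symbolMonomial_left (fun i => hxy.commute_xy _ _ (hne i))
          (fun i => hxy.commute_yy _ _ (hne i)) J)) h
    have hxy' : SymbolCommRel (fun i : Fin m => x i.castSucc) (fun i => y i.castSucc) :=
      ⟨fun i => hxy.mul_eq _, fun i => hxy.isUnit _,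
        fun i j hij => hxy.commute_xx _ _ fun h => hij (Fin.castSucc_injective _ h),
        fun i j hij => hxy.commute_yy _ _ fun h => hij (Fin.castSucc_injective _ h),
        fun i j hij => hxy.commute_xy _ _ fun h => hij (Fin.castSucc_injective _ h)⟩
    ext J
    have h2 := ih hxy' (fun J' => c (Fin.snoc J' (J (Fin.last m)))) (fun _ _ => hcx _ _)
      (fun _ _ => hcy _ _) (congrFun h1 (J (Fin.last m)))
    have h3 := congrFun h2 (fun i => J i.castSucc)
    have h4 : (Fin.snoc (fun i : Fin m => J i.castSucc) (J (Fin.last m)) :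
      Fin (m + 1) → Fin p × Fin p) = J := Fin.snoc_init_self J
    rw [← h4]
    exact h3

namespace ASSymbol

variable {F : Type} [Field F] {p : ℕ} {a b : F}

/-- The quotient map from the free algebra onto a symbol algebra. -/
noncomputable def mk (F : Type) [Field F] (p : ℕ) (a b : F) :
    FreeAlgebra F (Fin 2) →ₐ[F] ASSymbol F p a b :=
  RingQuot.mkAlgHom F (ASSymbolRel F p a b)

theorem mk_surjective : Function.Surjective (mk F p a b) :=
  RingQuot.mkAlgHom_surjective F _

/-- The generator `x` of a symbol algebra. -/
noncomputable def x (F : Type) [Field F] (p : ℕ) (a b : F) : ASSymbol F p a b :=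
  mk F p a b (SymGenX F)

/-- The generator `y` of a symbol algebra. -/
noncomputable def y (F : Type) [Field F] (p : ℕ) (a b : F) : ASSymbol F p a b :=
  mk F p a b (SymGenY F)

theorem x_pow_sub : x F p a b ^ p - x F p a b = algebraMap F _ a := by
  have h := RingQuot.mkAlgHom_rel F (ASSymbolRel.x (F := F) (p := p) (a := a) (b := b))
  change mk F p a b _ = mk F p a b _ at h
  rwa [map_sub, map_pow, AlgHom.commutes] at h

theorem y_pow : y F p a b ^ p = algebraMap F _ b := by
  have h := RingQuot.mkAlgHom_rel F (ASSymbolRel.y (F := F) (p := p) (a := a) (b := b))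
  change mk F p a b _ = mk F p a b _ at h
  rwa [map_pow, AlgHom.commutes] at h

theorem y_mul_x : y F p a b * x F p a b = (x F p a b + 1) * y F p a b := by
  have h := RingQuot.mkAlgHom_rel F (ASSymbolRel.comm (F := F) (p := p) (a := a) (b := b))
  change mk F p a b _ = mk F p a b _ at h
  rwa [map_mul, map_mul, map_add, map_one] at h

theorem induction {motive : ASSymbol F p a b → Prop}
    (algebraMap : ∀ r, motive (algebraMap F _ r)) (x : motive (x F p a b))
    (y : motive (y F p a b)) (mul : ∀ z w, motive z → motive w → motive (z * w))
    (add : ∀ z w, motive z → motive w → motive (z + w)) (z : ASSymbol F p a b) : motive z := by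
  obtain ⟨z, rfl⟩ := mk_surjective z
  induction z using FreeAlgebra.induction with
  | grade0 r => rw [AlgHom.commutes]; exact algebraMap r
  | grade1 i =>
    match i with
    | 0 => exact x
    | 1 => exact y
  | mul z w hz hw => rw [map_mul]; exact mul _ _ hz hw
  | add z w hz hw => rw [map_add]; exact add _ _ hz hw

/-- The universal property of a symbol algebra. -/
theorem exists_algHom {R : Type} [Ring R] [Algebra F R] {u v : R}
    (hu : u ^ p - u = algebraMap F R a) (hv : v ^ p = algebraMap F R b)
    (huv : v * u = (u + 1) * v) :
    ∃ f : ASSymbol F p a b →ₐ[F] R, f (x F p a b) = u ∧ f (y F p a b) = v := by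
  let g : FreeAlgebra F (Fin 2) →ₐ[F] R := FreeAlgebra.lift F ![u, v]
  have hgx : g (SymGenX F) = u := by simp [g, SymGenX]
  have hgy : g (SymGenY F) = v := by simp [g, SymGenY]
  have hg : ∀ ⦃z w⦄, ASSymbolRel F p a b z w → g z = g w := by
    rintro _ _ (_ | _ | _)
    · rw [map_sub, map_pow, hgx, hu, AlgHom.commutes]
    · rw [map_pow, hgy, hv, AlgHom.commutes]
    · rw [map_mul, map_mul, map_add, map_one, hgx, hgy, huv]
  refine ⟨RingQuot.liftAlgHom F ⟨g, hg⟩, ?_, ?_⟩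
  · exact (RingQuot.liftAlgHom_mkAlgHom_apply F g hg (SymGenX F)).trans hgx
  · exact (RingQuot.liftAlgHom_mkAlgHom_apply F g hg (SymGenY F)).trans hgy

theorem commute_algHom {R : Type} [Ring R] [Algebra F R] (f : ASSymbol F p a b →ₐ[F] R) {w : R}
    (hx : Commute (f (x F p a b)) w) (hy : Commute (f (y F p a b)) w) (z : ASSymbol F p a b) :
    Commute (f z) w := by
  induction z using ASSymbol.induction with
  | algebraMap r => rw [AlgHom.commutes]; exact Algebra.commute_algebraMap_left _ _
  | x => exact hx
  | y => exact hy
  | mul z w hz hw => rw [map_mul]; exact hz.mul_left hw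
  | add z w hz hw => rw [map_add]; exact hz.add_left hw

theorem span_monomials (hp : p.Prime) : Submodule.span F (Set.range fun q : Fin p × Fin p =>
    x F p a b ^ q.1.val * y F p a b ^ q.2.val) = ⊤ := by
  set W := Submodule.span F (Set.range fun q : Fin p × Fin p =>
    x F p a b ^ q.1.val * y F p a b ^ q.2.val)
  have hmem : ∀ i j, i < p → j < p → x F p a b ^ i * y F p a b ^ j ∈ W := fun i j hi hj =>
    Submodule.subset_span ⟨(⟨i, hi⟩, ⟨j, hj⟩), rfl⟩
  have hxy : ∀ i, y F p a b * x F p a b ^ i = (x F p a b + 1) ^ i * y F p a b := fun i =>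
    (show SemiconjBy (y F p a b) (x F p a b) (x F p a b + 1) from y_mul_x).pow_right i
  have hmem' : ∀ i j, i < p → j ≤ p → x F p a b ^ i * y F p a b ^ j ∈ W := by
    intro i j hi hj
    rcases hj.lt_or_eq with hj | rfl
    · exact hmem i j hi hj
    · rw [y_pow, ← Algebra.commutes, ← Algebra.smul_def]
      have := hmem i 0 hi hp.pos
      rw [pow_zero, mul_one] at this
      exact W.smul_mem _ this
  have hleft : ∀ u : ASSymbol F p a b, (∀ i j, i < p → j < p →
      u * (x F p a b ^ i * y F p a b ^ j) ∈ W) → ∀ w ∈ W, u * w ∈ W := by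
    intro u hu w hw
    induction hw using Submodule.span_induction with
    | mem w hw =>
      obtain ⟨q, rfl⟩ := hw
      exact hu _ _ q.1.2 q.2.2
    | zero => rw [mul_zero]; exact W.zero_mem
    | add v w _ _ hv hw => rw [mul_add]; exact W.add_mem hv hw
    | smul r w _ hw => rw [mul_smul_comm]; exact W.smul_mem _ hw
  have key : ∀ z : ASSymbol F p a b, ∀ w ∈ W, z * w ∈ W := by
    intro z
    induction z using ASSymbol.induction with
    | algebraMap r => intro w hw; rw [← Algebra.smul_def]; exact W.smul_mem _ hw
    | x =>
      refine hleft _ fun i j hi hj => ?_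
      rw [← mul_assoc, ← pow_succ']
      rcases (Nat.succ_le_of_lt hi).lt_or_eq with h | h
      · exact hmem _ _ h hj
      · rw [← Nat.succ_eq_add_one, h, eq_add_of_sub_eq x_pow_sub, add_mul, ← Algebra.smul_def]
        refine W.add_mem (W.smul_mem _ ?_) ?_
        · simpa using hmem 0 j hp.pos hj
        · simpa using hmem 1 j hp.one_lt hj
    | y =>
      refine hleft _ fun i j hi hj => ?_
      rw [← mul_assoc, hxy, mul_assoc, ← pow_succ', (Commute.one_right _).add_pow, Finset.sum_mul]
      refine W.sum_mem fun l hl => ?_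
      rw [one_pow, mul_one, mul_assoc, (Nat.cast_commute (i.choose l) (y F p a b ^ (j + 1))).eq,
        ← mul_assoc, ← (Nat.cast_commute (i.choose l) _).eq, ← nsmul_eq_mul]
      exact W.nsmul_mem (hmem' _ _ (by have := Finset.mem_range.1 hl; omega) (by omega)) _
    | mul u v hu hv => intro w hw; rw [mul_assoc]; exact hu _ (hv _ hw)
    | add u v hu hv => intro w hw; rw [add_mul]; exact W.add_mem (hu _ hw) (hv _ hw)
  refine eq_top_iff.2 fun z _ => ?_
  have := key z _ (hmem 0 0 hp.pos hp.pos)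
  simpa using this

end ASSymbol

theorem List.prod_ofFn_mul_of_commute {R : Type*} [Monoid R] {m : ℕ} (u v : Fin m → R)
    (h : ∀ i j, i ≠ j → Commute (v i) (u j)) :
    (List.ofFn fun i => u i * v i).prod = (List.ofFn u).prod * (List.ofFn v).prod := by
  induction m with
  | zero => simp
  | succ m ih =>
    simp only [List.ofFn_succ, List.prod_cons]
    rw [ih _ _ fun i j hij => h _ _ fun h => hij (Fin.succ_injective _ h)]
    have : Commute (v 0) (List.ofFn fun i : Fin m => u i.succ).prod := by
      refine Commute.list_prod_right _ _ fun w hw => ?_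
      obtain ⟨i, rfl⟩ := (List.mem_ofFn' _ _).1 hw
      exact h _ _ (Fin.succ_ne_zero i).symm
    rw [mul_assoc, mul_assoc, ← mul_assoc (v 0), this.eq, mul_assoc]

/-- A tensor product of symbol algebras is a division algebra as soon as it has a representation
in which no nontrivial combination of monomials is a left zero divisor. -/
theorem isDivisionAlgebra_piTensorProduct {F : Type} [Field F] {p : ℕ} (hp : p.Prime) {m : ℕ}
    (a b : Fin m → F) {R : Type} [Ring R] [Nontrivial R] [Algebra F R] (x y : Fin m → R)
    (hxy : SymbolCommRel x y) (hx : ∀ i, x i ^ p - x i = algebraMap F R (a i))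
    (hy : ∀ i, y i ^ p = algebraMap F R (b i))
    (hreg : ∀ c : (Fin m → Fin p × Fin p) → F, c ≠ 0 → ∀ w : R,
      (∑ J, c J • symbolMonomial x y J) * w = 0 → w = 0) :
    IsDivisionAlgebra (⨂[F] i, ASSymbol F p (a i) (b i)) := by
  choose f hfx hfy using fun i => ASSymbol.exists_algHom (hx i) (hy i) (hxy.mul_eq i)
  have hcomm : ∀ i j, i ≠ j → ∀ z w, Commute (f i z) (f j w) := by
    intro i j hij z w
    refine ASSymbol.commute_algHom _ ?_ ?_ z
    · refine (ASSymbol.commute_algHom _ ?_ ?_ w).symm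
      · rw [hfx, hfx]; exact hxy.commute_xx _ _ hij.symm
      · rw [hfx, hfy]; exact (hxy.commute_xy _ _ hij).symm
    · refine (ASSymbol.commute_algHom _ ?_ ?_ w).symm
      · rw [hfx, hfy]; exact hxy.commute_xy _ _ hij.symm
      · rw [hfy, hfy]; exact (hxy.commute_yy _ _ hij).symm
  let g : (⨂[F] i, ASSymbol F p (a i) (b i)) →ₐ[F] R :=
    PiTensorProduct.liftAlgHom
      ((MultilinearMap.mkPiAlgebraFin F m R).compLinearMap fun i => (f i).toLinearMap)
      (by simp [List.ofFn_const])
      (fun z w => by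
        simp only [MultilinearMap.compLinearMap_apply, MultilinearMap.mkPiAlgebraFin_apply,
          AlgHom.toLinearMap_apply, Pi.mul_apply, map_mul]
        exact List.prod_ofFn_mul_of_commute _ _ fun i j hij => hcomm i j hij _ _)
  have hspan := PiTensorProduct.submodule_span_eq_top (R := F)
    (M := fun i => ASSymbol F p (a i) (b i))
    (g := fun i (q : Fin p × Fin p) => ASSymbol.x F p (a i) (b i) ^ q.1.val *
      ASSymbol.y F p (a i) (b i) ^ q.2.val) (fun i => ASSymbol.span_monomials hp)
  have hg : ∀ z, z ≠ 0 → ∀ w, g z * w = 0 → w = 0 := by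
    intro z hz w hw
    have hmem : z ∈ Submodule.span F _ := hspan ▸ Submodule.mem_top
    obtain ⟨c, rfl⟩ := (Submodule.mem_span_range_iff_exists_fun F).1 hmem
    refine hreg c (fun hc => hz (by simp [hc])) w ?_
    rw [map_sum] at hw
    convert hw using 3 with J
    rw [map_smul]
    congr 1
    simp only [g, PiTensorProduct.liftAlgHom_apply, PiTensorProduct.lift.tprod]
    simp [symbolMonomial, hfx, hfy]
  have hnt : Nontrivial (⨂[F] i, ASSymbol F p (a i) (b i)) := g.toRingHom.domain_nontrivial
  have : NoZeroDivisors (⨂[F] i, ASSymbol F p (a i) (b i)) := by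
    refine ⟨fun {z w} hzw => or_iff_not_imp_left.2 fun hz => by_contra fun hw => ?_⟩
    have h1 : g z * g w = 0 := by rw [← map_mul, hzw, map_zero]
    have h2 := hg w hw 1 (by rw [mul_one]; exact hg z hz _ h1)
    exact one_ne_zero h2
  have : IsDomain (⨂[F] i, ASSymbol F p (a i) (b i)) := NoZeroDivisors.to_isDomain _
  have : FiniteDimensional F (⨂[F] i, ASSymbol F p (a i) (b i)) :=
    Module.finite_def.2 (hspan ▸ Submodule.fg_span (Set.finite_range _))
  exact ⟨hnt, fun z hz => FiniteDimensional.isUnit F hz⟩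

theorem HahnSeries.coeff_mul_add_of_lt {S : Type*} [Ring S] {f g : HahnSeries ℤ S} {N n : ℤ}
    (hf : ∀ i < N, f.coeff i = 0) (hg : ∀ i < n, g.coeff i = 0) :
    (f * g).coeff (N + n) = f.coeff N * g.coeff n := by
  rw [HahnSeries.coeff_mul, Finset.sum_eq_single (N, n)]
  · rintro ⟨i, j⟩ hij hne
    rw [Finset.mem_antidiagonal, HahnSeries.mem_support, HahnSeries.mem_support] at hij
    have hi : N ≤ i := not_lt.1 fun h => hij.1 (hf i h)
    have hj : n ≤ j := not_lt.1 fun h => hij.2.1 (hg j h)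
    obtain ⟨rfl, rfl⟩ : i = N ∧ j = n := by have := hij.2.2; omega
    exact absurd rfl hne
  · intro h
    rw [Finset.mem_antidiagonal, HahnSeries.mem_support, HahnSeries.mem_support] at h
    by_cases h0 : f.coeff N = 0
    · simp [h0]
    · have : g.coeff n = 0 := by simpa [h0] using h
      simp [this]

section Filtration

variable {S : Type*} [Ring S] {p : ℕ}

/-- The `e`-th coefficient of a vector of Laurent series, where the coefficient of `t ^ N` in the
`a`-th entry is placed in degree `p * N - a`. -/
def gradedCoeff (hp : 0 < p) (e : ℤ) : (Fin p → HahnSeries ℤ S) →+ S where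
  toFun v := (v ⟨((-e) % p).toNat, by
    have := Int.emod_lt_of_pos (-e) (Int.natCast_pos.2 hp)
    have := Int.emod_nonneg (-e) (Int.natCast_pos.2 hp).ne'
    omega⟩).coeff (-((-e) / p))
  map_zero' := by simp
  map_add' := by simp

theorem gradedCoeff_apply (hp : 0 < p) (N : ℤ) (a : Fin p) (v : Fin p → HahnSeries ℤ S) :
    gradedCoeff hp (p * N - a) v = (v a).coeff N := by
  have ha : ((a : ℕ) : ℤ) < p := by exact_mod_cast a.2
  have h0 : (0 : ℤ) < p := by exact_mod_cast hp
  have hmod : (-(p * N - (a : ℤ))) % p = a := by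
    rw [show -(p * N - (a : ℤ)) = a + p * (-N) by ring, Int.add_mul_emod_self_left]
    exact Int.emod_eq_of_lt (by positivity) ha
  have hdiv : -((-(p * N - (a : ℤ))) / p) = N := by
    rw [show -(p * N - (a : ℤ)) = a + p * (-N) by ring, Int.add_mul_ediv_left _ _ h0.ne',
      Int.ediv_eq_zero_of_lt (by positivity) ha]
    ring
  change (v ⟨_, _⟩).coeff _ = _
  rw [hdiv]
  congr 2
  exact Fin.ext (by rw [Fin.val_mk, hmod, Int.toNat_natCast])

theorem exists_eq_mul_sub (hp : 0 < p) (e : ℤ) : ∃ (N : ℤ) (a : Fin p), e = p * N - a := by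
  have h0 : (0 : ℤ) < p := by exact_mod_cast hp
  have h1 := Int.emod_lt_of_pos (-e) h0
  have h2 := Int.emod_nonneg (-e) h0.ne'
  have h3 := Int.mul_ediv_add_emod (-e) p
  refine ⟨-((-e) / p), ⟨((-e) % p).toNat, by omega⟩, ?_⟩
  simp only [Int.toNat_of_nonneg h2]
  linarith

theorem mul_sub_eq_mul_sub_iff {N N' : ℤ} {a a' : Fin p} :
    (p * N - a : ℤ) = p * N' - a' ↔ N = N' ∧ a = a' := by
  refine ⟨fun h => ?_, fun h => by rw [h.1, h.2]⟩
  have h1 : ((a : ℕ) : ℤ) < p := by exact_mod_cast a.2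
  have h2 : ((a' : ℕ) : ℤ) < p := by exact_mod_cast a'.2
  have hN : N = N' := by nlinarith
  subst hN
  exact ⟨rfl, Fin.ext (by omega)⟩

/-- The matrix `T` shifts the filtration by `M`, and acts on the leading coefficient by left
multiplication by `z`. -/
def HasLeadingCoeff (hp : 0 < p) (T : Matrix (Fin p) (Fin p) (HahnSeries ℤ S)) (M : ℤ) (z : S) :
    Prop :=
  ∀ e v, (∀ e' < e, gradedCoeff hp e' v = 0) →
    gradedCoeff hp (e + M) (T.mulVec v) = z * gradedCoeff hp e v

namespace HasLeadingCoeff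

variable {hp : 0 < p} {T T' : Matrix (Fin p) (Fin p) (HahnSeries ℤ S)} {M M' : ℤ} {z z' : S}

theorem one : HasLeadingCoeff hp (1 : Matrix (Fin p) (Fin p) (HahnSeries ℤ S)) 0 1 := by
  intro e v _
  simp

theorem vanish (h : HasLeadingCoeff hp T M z) {e : ℤ} {v : Fin p → HahnSeries ℤ S}
    (hv : ∀ e' < e, gradedCoeff hp e' v = 0) :
    ∀ e' < e + M, gradedCoeff hp e' (T.mulVec v) = 0 := by
  intro e' he'
  have := h (e' - M) v fun e'' h'' => hv _ (by omega)
  rwa [sub_add_cancel, hv _ (by omega), mul_zero] at this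

theorem mul (h : HasLeadingCoeff hp T M z) (h' : HasLeadingCoeff hp T' M' z') :
    HasLeadingCoeff hp (T * T') (M + M') (z * z') := by
  intro e v hv
  rw [← Matrix.mulVec_mulVec, show e + (M + M') = e + M' + M by ring, h _ _ (h'.vanish hv),
    h' _ _ hv, mul_assoc]

theorem pow (h : HasLeadingCoeff hp T M z) (n : ℕ) : HasLeadingCoeff hp (T ^ n) (n * M) (z ^ n) := by
  induction n with
  | zero => simpa using one
  | succ n ih =>
    rw [pow_succ, pow_succ]
    have := ih.mul h
    rwa [show (n * M + M : ℤ) = (n + 1 : ℕ) * M by push_cast; ring] at this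

theorem sum {ι : Type*} (s : Finset ι) {T : ι → Matrix (Fin p) (Fin p) (HahnSeries ℤ S)}
    {z : ι → S} (h : ∀ i ∈ s, HasLeadingCoeff hp (T i) M (z i)) :
    HasLeadingCoeff hp (∑ i ∈ s, T i) M (∑ i ∈ s, z i) := by
  intro e v hv
  rw [Matrix.sum_mulVec, map_sum, Finset.sum_mul]
  exact Finset.sum_congr rfl fun i hi => h i hi e v hv

theorem of_lt (h : HasLeadingCoeff hp T M z) (hM : M' < M) : HasLeadingCoeff hp T M' 0 := by
  intro e v hv
  rw [h.vanish hv _ (by omega), zero_mul]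

/-- Every nonzero vector has a leading coefficient. -/
theorem _root_.exists_gradedCoeff_ne_zero (hp : 0 < p) {v : Fin p → HahnSeries ℤ S}
    (hv : v ≠ 0) :
    ∃ e, gradedCoeff hp e v ≠ 0 ∧ ∀ e' < e, gradedCoeff hp e' v = 0 := by
  obtain ⟨B, hB⟩ : ∃ B : ℤ, ∀ a, B ≤ (v a).order := by
    obtain ⟨B, hB⟩ := (Set.finite_range fun a => (v a).order).bddBelow
    exact ⟨B, fun a => hB ⟨a, rfl⟩⟩
  obtain ⟨e, he, hmin⟩ := Int.exists_least_of_bdd (P := fun e => gradedCoeff hp e v ≠ 0)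
    ⟨p * B - p, fun e he => by
      obtain ⟨N, a, rfl⟩ := exists_eq_mul_sub hp e
      rw [gradedCoeff_apply] at he
      have h1 := (hB a).trans (HahnSeries.order_le_of_coeff_ne_zero he)
      have h2 : ((a : ℕ) : ℤ) < p := by exact_mod_cast a.2
      nlinarith⟩
    (by
      obtain ⟨a, ha⟩ := Function.ne_iff.1 hv
      obtain ⟨N, hN⟩ : ∃ N, (v a).coeff N ≠ 0 := by
        by_contra! h
        exact ha (HahnSeries.ext (funext h))
      exact ⟨p * N - a, by rwa [gradedCoeff_apply]⟩)
  exact ⟨e, he, fun e' he' => by by_contra h; exact absurd (hmin e' h) (by omega)⟩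

theorem eq_zero_of_mul_eq_zero [NoZeroDivisors S] (h : HasLeadingCoeff hp T M z) (hz : z ≠ 0)
    {W : Matrix (Fin p) (Fin p) (HahnSeries ℤ S)} (hW : T * W = 0) : W = 0 := by
  by_contra hne
  obtain ⟨j, hj⟩ : ∃ j, W.col j ≠ 0 := by
    by_contra! h0
    exact hne (Matrix.ext fun i j => congrFun (h0 j) i)
  obtain ⟨e, he, hlt⟩ := exists_gradedCoeff_ne_zero hp hj
  have h0 : T.mulVec (W.col j) = 0 := by
    ext1 i
    exact congrFun (congrFun hW i) j
  have := h e _ hlt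
  rw [h0, map_zero] at this
  exact mul_ne_zero hz he this.symm

/-- The leading coefficient of a scalar matrix. -/
theorem scalar {b : HahnSeries ℤ S} {N : ℤ} (hb : ∀ n < N, b.coeff n = 0) :
    HasLeadingCoeff hp (Matrix.scalar (Fin p) b) (p * N) (b.coeff N) := by
  intro e v hv
  obtain ⟨n, a, rfl⟩ := exists_eq_mul_sub hp e
  have h0 : ∀ n' < n, (v a).coeff n' = 0 := fun n' hn' => by
    rw [← gradedCoeff_apply hp]
    refine hv _ ?_
    have : (0 : ℤ) < p := by exact_mod_cast hp
    nlinarith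
  rw [show (p * n - a + p * N : ℤ) = p * (N + n) - a by ring, gradedCoeff_apply, gradedCoeff_apply]
  simp only [Matrix.scalar_apply, Matrix.mulVec_diagonal]
  exact HahnSeries.coeff_mul_add_of_lt hb h0

end HasLeadingCoeff

end Filtration

/-- The matrices, in the basis `1, ξ, …, ξ ^ (p - 1)` of the Artin–Schreier algebra
`F[ξ] / (ξ ^ p - ξ - τ)`, of the multiplication by `ξ` and of the automorphism `ξ ↦ ξ + 1`. -/
theorem exists_artinSchreier_matrices (F : Type*) [Field F] {p : ℕ} (hp : p.Prime) [CharP F p]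
    (τ : F) :
    ∃ X Y : Matrix (Fin p) (Fin p) F,
      X ^ p - X = algebraMap F _ τ ∧ Y ^ p = 1 ∧ Y * X = (X + 1) * Y ∧
      (∀ i a : Fin p, (a : ℕ) + 1 < p → X i a = if (i : ℕ) = a + 1 then 1 else 0) ∧
      (∀ i a : Fin p, (a : ℕ) + 1 = p → X i a =
        if (i : ℕ) = 0 then τ else if (i : ℕ) = 1 then 1 else 0) ∧
      ∀ i a : Fin p, Y i a = ((a : ℕ).choose i : F) := by
  open Polynomial in
  let f : F[X] := X ^ p - (X + C τ)
  have hdeg : degree (X + C τ : F[X]) < p := by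
    rw [degree_X_add_C]; exact_mod_cast hp.one_lt
  have hf : f.Monic := monic_X_pow_sub hdeg
  have hfd : f.natDegree = p := by
    rw [natDegree_sub_eq_left_of_natDegree_lt, natDegree_X_pow]
    rw [natDegree_X_pow, natDegree_X_add_C]
    exact hp.one_lt
  let L := AdjoinRoot f
  let β : Module.Basis (Fin p) F L := (AdjoinRoot.powerBasis' hf).basis.reindex (finCongr hfd)
  let ξ : L := AdjoinRoot.root f
  have hβ : ∀ i, β i = ξ ^ (i : ℕ) := fun i => by
    rw [Module.Basis.reindex_apply, PowerBasis.basis_eq_pow]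
    rfl
  have hξ : ξ ^ p = ξ + algebraMap F L τ := by
    have := AdjoinRoot.eval₂_root f
    simp only [f, eval₂_sub, eval₂_pow, eval₂_X, eval₂_add, eval₂_C] at this
    exact sub_eq_zero.1 this
  have : Nontrivial L := AdjoinRoot.nontrivial f (by
    rw [degree_eq_natDegree hf.ne_zero, hfd]; exact_mod_cast hp.pos.ne')
  have : CharP L p := charP_of_injective_algebraMap (algebraMap F L).injective p
  have : Fact p.Prime := ⟨hp⟩
  let σ : L →ₐ[F] L := AdjoinRoot.liftAlgHom f (Algebra.ofId F L) (ξ + 1) (by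
    simp only [f, eval₂_sub, eval₂_pow, eval₂_X, eval₂_add, eval₂_C]
    rw [add_pow_char, hξ, one_pow]
    simp
    ring)
  have hσ : σ ξ = ξ + 1 := AdjoinRoot.liftAlgHom_root ..
  have hσn : ∀ n : ℕ, (σ ^ n) ξ = ξ + n := by
    intro n
    induction n with
    | zero => simp
    | succ n ih => rw [pow_succ', AlgHom.mul_apply, ih, map_add, hσ, map_natCast]; push_cast; ring
  have hσp : σ ^ p = 1 := AdjoinRoot.algHom_ext (by
    change (σ ^ p) ξ = ξ
    rw [hσn, CharP.cast_eq_zero, add_zero])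
  let e := LinearMap.toMatrixAlgEquiv β
  have he : ∀ (g : L →ₗ[F] L) i a, e g i a = β.repr (g (ξ ^ (a : ℕ))) i := fun g i a => by
    rw [LinearMap.toMatrixAlgEquiv_apply, hβ]
  have hrepr : ∀ n (h : n < p) (i : Fin p), β.repr (ξ ^ n) i = if (i : ℕ) = n then 1 else 0 := by
    intro n h i
    rw [show ξ ^ n = β ⟨n, h⟩ from (hβ ⟨n, h⟩).symm, Module.Basis.repr_self, Finsupp.single_apply]
    simp only [Fin.ext_iff, eq_comm]
  refine ⟨e (LinearMap.mulLeft F ξ), e σ.toLinearMap, ?_, ?_, ?_, ?_, ?_, ?_⟩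
  · rw [← map_pow, ← map_sub, ← AlgEquiv.commutes e]
    congr 1
    ext1 v
    simp [LinearMap.pow_mulLeft, hξ, add_mul, Algebra.smul_def]
  · rw [← map_pow, ← map_one e]
    congr 1
    ext1 v
    have : ∀ n : ℕ, (σ.toLinearMap ^ n) v = (σ ^ n) v := fun n => by
      induction n with
      | zero => rfl
      | succ n ih => rw [pow_succ', pow_succ', Module.End.mul_apply, ih]; rfl
    rw [this, hσp]
    rfl
  · rw [← map_mul, ← map_one e, ← map_add, ← map_mul]
    congr 1
    ext1 v
    simp [hσ, add_mul]
  · intro i a ha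
    rw [he, LinearMap.mulLeft_apply, ← pow_succ', hrepr _ ha]
  · intro i a ha
    rw [he, LinearMap.mulLeft_apply, ← pow_succ', ha, hξ, map_add, Finsupp.add_apply,
      ← pow_one ξ, hrepr _ hp.one_lt, Algebra.algebraMap_eq_smul_one, map_smul, ← pow_zero ξ,
      Finsupp.smul_apply, hrepr _ hp.pos]
    split_ifs <;> simp_all
  · intro i a
    rw [he, AlgHom.toLinearMap_apply, map_pow, hσ, add_pow, map_sum, Finsupp.finsetSum_apply,
      Finset.sum_congr rfl fun j hj => by
        rw [one_pow, mul_one, mul_comm, ← nsmul_eq_mul, map_nsmul, Finsupp.smul_apply,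
          hrepr _ (by have := a.2; have := Finset.mem_range.1 hj; omega)]]
    simp only [smul_ite, nsmul_eq_mul, mul_one, mul_zero, Finset.sum_ite_eq, Finset.mem_range]
    split_ifs with h
    · rfl
    · rw [Nat.choose_eq_zero_of_lt (by omega), Nat.cast_zero]

theorem HahnSeries.commute_of_coeff {S : Type*} [Ring S] {f g : HahnSeries ℤ S}
    (h : ∀ i j, Commute (f.coeff i) (g.coeff j)) : Commute f g := by
  ext n
  rw [HahnSeries.coeff_mul, HahnSeries.coeff_mul]
  refine Finset.sum_nbij' Prod.swap Prod.swap ?_ ?_ (fun _ _ => rfl) (fun _ _ => rfl)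
    fun ij _ => h _ _
  all_goals
    rintro ⟨i, j⟩ hij
    rw [Finset.mem_antidiagonal] at hij ⊢
    exact ⟨hij.2.1, hij.1, by rw [← hij.2.2]; exact add_comm _ _⟩

/-- The coefficientwise map between rings of Laurent series. -/
noncomputable def laurentMap {K S : Type*} [Ring K] [Ring S] (φ : K →+* S) :
    HahnSeries ℤ K →+* HahnSeries ℤ S where
  toFun f := f.map φ
  map_zero' := by ext; simp
  map_one' := by ext n; simp [HahnSeries.coeff_one, apply_ite φ]
  map_add' f g := by ext; simp
  map_mul' f g := HahnSeries.map_mul (φ : K →ₙ+* S)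

/-- Laurent series over a `K`-algebra `S` form an algebra over Laurent series over `K`. -/
noncomputable abbrev laurentAlgebra (K S : Type*) [CommRing K] [Ring S] [Algebra K S] :
    Algebra (HahnSeries ℤ K) (HahnSeries ℤ S) :=
  RingHom.toAlgebra' (laurentMap (algebraMap K S)) fun _ _ =>
    HahnSeries.commute_of_coeff fun _ _ => Algebra.commute_algebraMap_left _ _

section LaurentAlgebra

attribute [local instance] laurentAlgebra

theorem coeff_algebraMap_laurent {K S : Type*} [CommRing K] [Ring S] [Algebra K S]
    (f : HahnSeries ℤ K) (n : ℤ) :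
    (algebraMap (HahnSeries ℤ K) (HahnSeries ℤ S) f).coeff n = algebraMap K S (f.coeff n) :=
  rfl

theorem algebraMap_laurent_single {K S : Type*} [CommRing K] [Ring S] [Algebra K S] (n : ℤ)
    (a : K) :
    algebraMap (HahnSeries ℤ K) (HahnSeries ℤ S) (HahnSeries.single n a) =
      HahnSeries.single n (algebraMap K S a) := by
  ext k
  rw [coeff_algebraMap_laurent, HahnSeries.coeff_single, HahnSeries.coeff_single]
  split_ifs <;> simp

theorem algebraMap_laurent_C {K S : Type*} [CommRing K] [Ring S] [Algebra K S] (a : K) :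
    algebraMap (HahnSeries ℤ K) (HahnSeries ℤ S) (HahnSeries.C a) =
      HahnSeries.C (algebraMap K S a) :=
  algebraMap_laurent_single 0 a

end LaurentAlgebra

namespace HasLeadingCoeff

variable {S : Type*} [Ring S] {p : ℕ} {hp : 0 < p}
  {T : Matrix (Fin p) (Fin p) (HahnSeries ℤ S)} {M : ℤ} {z : S}

theorem of_entries
    (h0 : ∀ (i a : Fin p) (n : ℤ), (p * n - i + a : ℤ) < M → (T i a).coeff n = 0)
    (h1 : ∀ (i a : Fin p) (n : ℤ), (p * n - i + a : ℤ) = M → (T i a).coeff n = z) :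
    HasLeadingCoeff hp T M z := by
  intro e v hv
  obtain ⟨N, i, hN⟩ := exists_eq_mul_sub hp (e + M)
  obtain ⟨n, a, rfl⟩ := exists_eq_mul_sub hp e
  have hv' : ∀ (k : ℤ) (b : Fin p), (p * k - b : ℤ) < p * n - a → (v b).coeff k = 0 :=
    fun k b hk => by rw [← gradedCoeff_apply hp]; exact hv _ hk
  have hpos : (0 : ℤ) < p := by exact_mod_cast hp
  rw [hN, gradedCoeff_apply, gradedCoeff_apply, Matrix.mulVec, dotProduct, HahnSeries.coeff_sum,
    Finset.sum_eq_single a]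
  · rw [← h1 i a (N - n) (by linarith), ← HahnSeries.coeff_mul_add_of_lt, sub_add_cancel]
    · exact fun k hk => h0 i a k (by nlinarith)
    · exact fun k hk => hv' k a (by nlinarith)
  · intro b _ hb
    rw [HahnSeries.coeff_mul]
    refine Finset.sum_eq_zero fun kl hkl => ?_
    obtain ⟨k, l⟩ := kl
    have hkl : k + l = N := (Finset.mem_antidiagonal.1 hkl).2.2
    subst hkl
    rcases lt_trichotomy (p * l - b : ℤ) (p * n - a) with h | h | h
    · rw [hv' l b h, mul_zero]
    · exact absurd (mul_sub_eq_mul_sub_iff.1 h).2 hb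
    · rw [h0 i b k (by nlinarith), zero_mul]
  · simp

/-- The leading coefficient of the matrix of the multiplication by a root of
`ξ ^ p - ξ = t ^ (-1)`. -/
theorem of_artinSchreier_mul
    (h0 : ∀ i a : Fin p, (a : ℕ) + 1 < p → T i a = if (i : ℕ) = a + 1 then 1 else 0)
    (h1 : ∀ i a : Fin p, (a : ℕ) + 1 = p → T i a =
      if (i : ℕ) = 0 then HahnSeries.single (-1) 1 else if (i : ℕ) = 1 then 1 else 0) :
    HasLeadingCoeff hp T (-1) 1 := by
  have hpos : (0 : ℤ) < p := by exact_mod_cast hp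
  refine of_entries (fun i a n h => ?_) (fun i a n h => ?_)
  all_goals
    have hi : ((i : ℕ) : ℤ) < p := by exact_mod_cast i.2
    have ha : ((a : ℕ) : ℤ) < p := by exact_mod_cast a.2
    rcases (show (a : ℕ) + 1 < p ∨ (a : ℕ) + 1 = p by omega) with hap | hap
  · rw [h0 i a hap]
    split_ifs with hia
    · rw [HahnSeries.coeff_one, if_neg]
      rintro rfl
      simp only [hia] at h
      push_cast at h
      linarith
    · simp
  · rw [h1 i a hap]
    have hap' : ((a : ℕ) : ℤ) + 1 = p := by exact_mod_cast hap
    split_ifs with hi0 hi1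
    · rw [HahnSeries.coeff_single_of_ne]
      rintro rfl
      simp only [hi0] at h
      push_cast at h
      linarith
    · rw [HahnSeries.coeff_one, if_neg]
      rintro rfl
      simp only [hi1] at h
      push_cast at h
      linarith
    · simp
  · have hn : n = 0 := by
      have : (a : ℤ) + 1 < p := by exact_mod_cast hap
      nlinarith
    subst hn
    rw [h0 i a hap, if_pos (by omega), HahnSeries.coeff_one, if_pos rfl]
  · have hap' : ((a : ℕ) : ℤ) + 1 = p := by exact_mod_cast hap
    have hn : n = -1 := by nlinarith
    subst hn
    rw [h1 i a hap, if_pos (by omega), HahnSeries.coeff_single_same]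

/-- The leading coefficient of the matrix of the substitution `ξ ↦ ξ + 1`. -/
theorem of_choose (h : ∀ i a : Fin p, T i a = ((a : ℕ).choose i : HahnSeries ℤ S)) :
    HasLeadingCoeff hp T 0 1 := by
  have hpos : (0 : ℤ) < p := by exact_mod_cast hp
  have hc : ∀ (c : ℕ) (n : ℤ), n ≠ 0 → (c : HahnSeries ℤ S).coeff n = 0 := fun c n hn => by
    rw [← map_natCast (HahnSeries.C : S →+* HahnSeries ℤ S), HahnSeries.C_apply,
      HahnSeries.coeff_single_of_ne hn]
  refine of_entries (fun i a n h' => ?_) (fun i a n h' => ?_)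
  · rw [h]
    rcases eq_or_ne n 0 with rfl | hn
    · rw [Nat.choose_eq_zero_of_lt (by omega), Nat.cast_zero, HahnSeries.coeff_zero]
    · exact hc _ _ hn
  · have hi : ((i : ℕ) : ℤ) < p := by exact_mod_cast i.2
    have ha : ((a : ℕ) : ℤ) < p := by exact_mod_cast a.2
    have hn : n = 0 := by nlinarith
    subst hn
    rw [h, show (i : ℕ) = a by omega, Nat.choose_self, Nat.cast_one, HahnSeries.coeff_one,
      if_pos rfl]

end HasLeadingCoeff

theorem map_symbolMonomial {R R' G : Type*} [Monoid R] [Monoid R'] [FunLike G R R']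
    [MonoidHomClass G R R'] (g : G) {m p : ℕ} (x y : Fin m → R) (J : Fin m → Fin p × Fin p) :
    symbolMonomial (fun i => g (x i)) (fun i => g (y i)) J = g (symbolMonomial x y J) := by
  rw [symbolMonomial, symbolMonomial, map_list_prod, List.map_ofFn]
  congr 2
  ext i
  simp

theorem SymbolCommRel.map {R R' : Type*} [Ring R] [Ring R'] (g : R →+* R') {m : ℕ}
    {x y : Fin m → R} (hxy : SymbolCommRel x y) :
    SymbolCommRel (fun i => g (x i)) (fun i => g (y i)) where
  mul_eq i := by rw [← map_mul, hxy.mul_eq, map_mul, map_add, map_one]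
  isUnit i := (hxy.isUnit i).map g
  commute_xx i j h := (hxy.commute_xx i j h).map g
  commute_yy i j h := (hxy.commute_yy i j h).map g
  commute_xy i j h := (hxy.commute_xy i j h).map g

theorem SymbolCommRel.snoc {R : Type*} [Ring R] {m : ℕ} {x y : Fin m → R}
    (hxy : SymbolCommRel x y) {x' y' : R} (h : y' * x' = (x' + 1) * y') (hy' : IsUnit y')
    (hxx : ∀ i, Commute (x i) x') (hxy' : ∀ i, Commute (x i) y')
    (hyx : ∀ i, Commute (y i) x') (hyy : ∀ i, Commute (y i) y') :
    SymbolCommRel (Fin.snoc x x' : Fin (m + 1) → R) (Fin.snoc y y' : Fin (m + 1) → R) where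
  mul_eq i := by
    induction i using Fin.lastCases with
    | last => simpa using h
    | cast i => simpa using hxy.mul_eq i
  isUnit i := by
    induction i using Fin.lastCases with
    | last => simpa using hy'
    | cast i => simpa using hxy.isUnit i
  commute_xx i j hij := by
    induction i using Fin.lastCases with
    | last =>
      induction j using Fin.lastCases with
      | last => exact absurd rfl hij
      | cast j => simpa using (hxx j).symm
    | cast i =>
      induction j using Fin.lastCases with
      | last => simpa using hxx i
      | cast j => simpa using hxy.commute_xx i j fun h => hij (by rw [h])
  commute_yy i j hij := by
    induction i using Fin.lastCases with
    | last =>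
      induction j using Fin.lastCases with
      | last => exact absurd rfl hij
      | cast j => simpa using (hyy j).symm
    | cast i =>
      induction j using Fin.lastCases with
      | last => simpa using hyy i
      | cast j => simpa using hxy.commute_yy i j fun h => hij (by rw [h])
  commute_xy i j hij := by
    induction i using Fin.lastCases with
    | last =>
      induction j using Fin.lastCases with
      | last => exact absurd rfl hij
      | cast j => simpa using (hyx j).symm
    | cast i =>
      induction j using Fin.lastCases with
      | last => simpa using hxy' i
      | cast j => simpa using hxy.commute_xy i j fun h => hij (by rw [h])

section Step

attribute [local instance] laurentAlgebra

theorem commute_scalar_mapMatrix {K S : Type*} [CommRing K] [Ring S] [Algebra K S] {p : ℕ}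
    (s : HahnSeries ℤ S) (T : Matrix (Fin p) (Fin p) (HahnSeries ℤ K)) :
    Commute (Matrix.scalar (Fin p) s)
      ((algebraMap (HahnSeries ℤ K) (HahnSeries ℤ S)).mapMatrix T) := by
  refine Matrix.ext fun i j => ?_
  rw [Matrix.scalar_apply, Matrix.diagonal_mul, Matrix.mul_diagonal, RingHom.mapMatrix_apply,
    Matrix.map_apply]
  exact Algebra.commute_algebraMap_right (T i j) s

/-- The least degree at which some member of a nonzero family of Laurent series, with the member
of index `(J, q)` shifted by `-q.1`, has a nonzero coefficient. -/
theorem exists_least_shifted_degree {K Q : Type*} [Ring K] [Finite Q] {p : ℕ}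
    (c : Q → Fin p × Fin p → HahnSeries ℤ K) (hc : ∃ J q, c J q ≠ 0) :
    ∃ (N : ℤ) (a : Fin p), (∃ J j, (c J (a, j)).coeff N ≠ 0) ∧
      ∀ J q n, (p * n - (q.1 : ℕ) : ℤ) < p * N - a → (c J q).coeff n = 0 := by
  obtain ⟨B, hB⟩ : ∃ B : ℤ, ∀ Jq : Q × Fin p × Fin p, B ≤ (c Jq.1 Jq.2).order := by
    obtain ⟨B, hB⟩ := (Set.finite_range fun Jq : Q × Fin p × Fin p =>
      (c Jq.1 Jq.2).order).bddBelow
    exact ⟨B, fun a => hB ⟨a, rfl⟩⟩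
  obtain ⟨e, ⟨J, q, N, rfl, hN⟩, hmin⟩ := Int.exists_least_of_bdd
    (P := fun e => ∃ J q N, e = (p * N - (q.1 : ℕ) : ℤ) ∧ (c J q).coeff N ≠ 0)
    ⟨p * B - p, by
      rintro _ ⟨J, q, N, rfl, he⟩
      have h1 := (hB (J, q)).trans (HahnSeries.order_le_of_coeff_ne_zero he)
      have h2 : ((q.1 : ℕ) : ℤ) < p := by exact_mod_cast q.1.2
      nlinarith⟩
    (by
      obtain ⟨J, q, hq⟩ := hc
      obtain ⟨N, hN⟩ : ∃ N, (c J q).coeff N ≠ 0 := by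
        by_contra! h
        exact hq (HahnSeries.ext (funext h))
      exact ⟨_, J, q, N, rfl, hN⟩)
  refine ⟨N, q.1, ⟨J, q.2, hN⟩, fun J' q' n hn => ?_⟩
  by_contra h
  exact absurd (hmin _ ⟨J', q', n, rfl, h⟩) (by omega)

theorem isDivisionAlgebra_laurent_step {K S : Type} [Field K] [Ring S] [Nontrivial S]
    [NoZeroDivisors S] [Algebra K S] {p : ℕ} (hp : p.Prime) [CharP K p] {m : ℕ} {a b : Fin m → K}
    {α : K} (hα : α ≠ 0) {x y : Fin m → S} (hxy : SymbolCommRel x y)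
    (hx : ∀ i, x i ^ p - x i = algebraMap K S (a i)) (hy : ∀ i, y i ^ p = algebraMap K S (b i))
    {u : S} (hux : ∀ i, Commute u (x i)) (huy : ∀ i, Commute u (y i))
    (hu : u ^ p = algebraMap K S α)
    (hind : ∀ c : (Fin m → Fin p × Fin p) → Fin p → K,
      ∑ j : Fin p, ∑ J, c J j • (symbolMonomial x y J * u ^ j.val) = 0 → c = 0) :
    IsDivisionAlgebra (⨂[HahnSeries ℤ K] i : Fin (m + 1), ASSymbol (HahnSeries ℤ K) p
      ((Fin.snoc (fun i => HahnSeries.C (a i)) (HahnSeries.single (-1) 1) :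
        Fin (m + 1) → HahnSeries ℤ K) i)
      ((Fin.snoc (fun i => HahnSeries.C (b i)) (HahnSeries.C α) :
        Fin (m + 1) → HahnSeries ℤ K) i)) := by
  have hp0 : 0 < p := hp.pos
  have : NeZero p := ⟨hp.pos.ne'⟩
  have : CharP (HahnSeries ℤ K) p :=
    charP_of_injective_ringHom (f := (HahnSeries.C : K →+* HahnSeries ℤ K))
      HahnSeries.C_injective p
  obtain ⟨X, Y, hX, hY, hYX, hX0, hX1, hYc⟩ := exists_artinSchreier_matrices (HahnSeries ℤ K) hp
    (HahnSeries.single (-1) 1)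
  let ρ : Matrix (Fin p) (Fin p) (HahnSeries ℤ K) →+* Matrix (Fin p) (Fin p) (HahnSeries ℤ S) :=
    (algebraMap (HahnSeries ℤ K) (HahnSeries ℤ S)).mapMatrix
  let ι : S →+* Matrix (Fin p) (Fin p) (HahnSeries ℤ S) := (Matrix.scalar (Fin p)).comp HahnSeries.C
  have hιρ : ∀ s T, Commute (ι s) (ρ T) := fun s T => commute_scalar_mapMatrix _ _
  have hι : ∀ r : K, ι (algebraMap K S r) =
      algebraMap (HahnSeries ℤ K) (Matrix (Fin p) (Fin p) (HahnSeries ℤ S)) (HahnSeries.C r) :=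
    fun r => by
      change Matrix.scalar (Fin p) (HahnSeries.C (algebraMap K S r)) = _
      rw [← algebraMap_laurent_C]
      rfl
  have hρ : ∀ r, ρ (algebraMap _ _ r) =
      algebraMap (HahnSeries ℤ K) (Matrix (Fin p) (Fin p) (HahnSeries ℤ S)) r := fun r => by
    rw [Matrix.algebraMap_eq_diagonal, Matrix.algebraMap_eq_diagonal]
    exact Matrix.diagonal_map (map_zero _)
  have huu : IsUnit u := by
    rw [← isUnit_pow_iff hp.ne_zero, hu]
    exact (isUnit_iff_ne_zero.2 hα).map _
  have hYu : IsUnit Y := by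
    rw [← isUnit_pow_iff hp.ne_zero, hY]
    exact isUnit_one
  let x' : Fin (m + 1) → Matrix (Fin p) (Fin p) (HahnSeries ℤ S) :=
    Fin.snoc (fun i => ι (x i)) (ρ X)
  let y' : Fin (m + 1) → Matrix (Fin p) (Fin p) (HahnSeries ℤ S) :=
    Fin.snoc (fun i => ι (y i)) (ι u * ρ Y)
  refine isDivisionAlgebra_piTensorProduct hp _ _
    (R := Matrix (Fin p) (Fin p) (HahnSeries ℤ S)) x' y' ?_ ?_ ?_ ?_
  · refine SymbolCommRel.snoc (SymbolCommRel.map ι hxy) ?_ ?_ (fun i => hιρ _ _) (fun i => ?_)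
      (fun i => hιρ _ _) (fun i => ?_)
    · rw [mul_assoc, ← map_mul, hYX, map_mul, ← mul_assoc, (hιρ _ _).eq, mul_assoc, map_add,
        map_one]
    · exact (huu.map ι).mul (hYu.map ρ)
    · exact ((hux i).symm.map ι).mul_right (hιρ _ _)
    · exact ((huy i).symm.map ι).mul_right (hιρ _ _)
  · intro i
    induction i using Fin.lastCases with
    | last =>
      simp only [x', Fin.snoc_last]
      rw [← map_pow, ← map_sub, hX, hρ]
    | cast i =>
      simp only [x', Fin.snoc_castSucc]
      rw [← map_pow, ← map_sub, hx, hι]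
  · intro i
    induction i using Fin.lastCases with
    | last =>
      simp only [y', Fin.snoc_last]
      rw [(hιρ _ _).mul_pow, ← map_pow, ← map_pow, hu, hY, map_one, mul_one, hι]
    | cast i =>
      simp only [y', Fin.snoc_castSucc]
      rw [← map_pow, hy, hι]
  · intro c hc w hw
    obtain ⟨N, a₀, ⟨J₀, j₀, hN⟩, hmin⟩ := exists_least_shifted_degree
      (fun (J : Fin m → Fin p × Fin p) q => c (Fin.snoc J q)) (by
        by_contra! h
        exact hc (funext fun J => by
          rw [← Fin.snoc_init_self J]; exact h (Fin.init J) (J (Fin.last m))))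
    have hlX : HasLeadingCoeff hp0 (ρ X) (-1) 1 := HasLeadingCoeff.of_artinSchreier_mul
      (fun i a h => by
        change algebraMap (HahnSeries ℤ K) (HahnSeries ℤ S) (X i a) = _
        rw [hX0 i a h]
        split_ifs <;> simp)
      (fun i a h => by
        change algebraMap (HahnSeries ℤ K) (HahnSeries ℤ S) (X i a) = _
        rw [hX1 i a h]
        split_ifs
        · rw [algebraMap_laurent_single, map_one]
        · simp
        · simp)
    have hlY : HasLeadingCoeff hp0 (ρ Y) 0 1 := HasLeadingCoeff.of_choose fun i a => by
      change algebraMap (HahnSeries ℤ K) (HahnSeries ℤ S) (Y i a) = _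
      rw [hYc, map_natCast]
    have hlι : ∀ s, HasLeadingCoeff hp0 (ι s) 0 s := fun s => by
      have : HasLeadingCoeff hp0 (ι s) (p * 0) ((HahnSeries.C s : HahnSeries ℤ S).coeff 0) :=
        HasLeadingCoeff.scalar (b := HahnSeries.C s) fun n hn => by
          rw [HahnSeries.C_apply, HahnSeries.coeff_single_of_ne hn.ne]
      rwa [mul_zero, HahnSeries.C_apply, HahnSeries.coeff_single_same] at this
    have hmon : ∀ J (q : Fin p × Fin p), HasLeadingCoeff hp0 (symbolMonomial x' y' (Fin.snoc J q))
        (-(q.1 : ℕ)) (symbolMonomial x y J * u ^ q.2.val) := fun J q => by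
      rw [symbolMonomial_snoc]
      simp only [x', y', Fin.snoc_last, Fin.snoc_castSucc, map_symbolMonomial]
      have := (hlι (symbolMonomial x y J)).mul
        ((hlX.pow q.1.val).mul (((hlι u).mul hlY).pow q.2.val))
      simpa using this
    have hsmul : ∀ (r : HahnSeries ℤ K) (n : ℤ), (∀ k < n, r.coeff k = 0) → ∀ J q,
        HasLeadingCoeff hp0 (r • symbolMonomial x' y' (Fin.snoc J q)) (p * n - (q.1 : ℕ))
          (r.coeff n • (symbolMonomial x y J * u ^ q.2.val)) := fun r n hr J q => by
      rw [Algebra.smul_def, Algebra.smul_def]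
      refine HasLeadingCoeff.mul ?_ (hmon J q)
      rw [Matrix.algebraMap_eq_diagonal]
      exact HasLeadingCoeff.scalar (b := algebraMap _ (HahnSeries ℤ S) r) fun k hk => by
        rw [coeff_algebraMap_laurent, hr k hk, map_zero]
    have hsum := HasLeadingCoeff.sum Finset.univ (hp := hp0) (M := p * N - a₀)
      (z := fun q : Fin p × Fin p => if q.1 = a₀ then
        ∑ J, (c (Fin.snoc J q)).coeff N • (symbolMonomial x y J * u ^ q.2.val) else 0)
      (T := fun q => ∑ J, c (Fin.snoc J q) • symbolMonomial x' y' (Fin.snoc J q))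
      (fun q _ => by
        have hpos : (0 : ℤ) < p := by exact_mod_cast hp0
        split_ifs with hq
        · refine HasLeadingCoeff.sum _ fun J _ => ?_
          rw [← hq]
          exact hsmul _ _ (fun k hk => hmin J q k (by rw [hq]; nlinarith)) J q
        · rw [← Finset.sum_const_zero (s := (Finset.univ : Finset (Fin m → Fin p × Fin p)))]
          refine HasLeadingCoeff.sum _ fun J _ => ?_
          have hq1 : ((q.1 : ℕ) : ℤ) < p := by exact_mod_cast q.1.2
          have ha1 : ((a₀ : ℕ) : ℤ) < p := by exact_mod_cast a₀.2
          have hq' : (q.1 : ℕ) ≠ a₀ := fun h => hq (Fin.ext h)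
          rcases lt_or_gt_of_ne hq' with h | h
          · exact (hsmul _ N (fun k hk => hmin J q k (by nlinarith)) J q).of_lt (by omega)
          · exact (hsmul _ (N + 1) (fun k hk => hmin J q k (by nlinarith)) J q).of_lt
              (by linarith))
    rw [← sum_snoc fun J => c J • symbolMonomial x' y' J] at hsum
    refine hsum.eq_zero_of_mul_eq_zero ?_ hw
    intro hz
    rw [Fintype.sum_prod_type, Finset.sum_eq_single a₀ (by intro b _ hb; simp [hb]) (by simp)]
      at hz
    simp only [if_true] at hz
    exact hN (congrFun (congrFun (hind _ hz) J₀) j₀)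

end Step

theorem SymbolCommRel.add_central {R : Type*} [Ring R] {m : ℕ} {x y : Fin m → R}
    (hxy : SymbolCommRel x y) (z : Fin m → R) (hz : ∀ i r, Commute (z i) r) :
    SymbolCommRel (fun i => x i + z i) y where
  mul_eq i := by
    rw [mul_add, hxy.mul_eq, ← (hz i (y i)).eq, ← add_mul]
    congr 1
    abel
  isUnit := hxy.isUnit
  commute_xx i j h := ((hxy.commute_xx i j h).add_right (hz j _).symm).add_left (hz i _)
  commute_yy := hxy.commute_yy
  commute_xy i j h := (hxy.commute_xy i j h).add_left (hz i _)

/-- The tensor product of symbol algebras `[aᵢ, bᵢ)` over `F` is a division algebra. -/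
def IsDivisionSymbolTensor (F : Type) [Field F] (p : ℕ) {m : ℕ} (a b : Fin m → F) : Prop :=
  IsDivisionAlgebra (⨂[F] i, ASSymbol F p (a i) (b i))

theorem SymbolCommRel.isDivisionSymbolTensor_laurent {K S : Type} [Field K] [Ring S] [Nontrivial S]
    [NoZeroDivisors S] {p : ℕ} (hp : p.Prime) [CharP K p] {m : ℕ} {x y : Fin m → S}
    (hxy : SymbolCommRel x y) {φ : K →+* S} (hφ : ∀ r s, Commute (φ r) s) {a b : Fin m → K}
    (hx : ∀ i, x i ^ p - x i = φ (a i)) (hy : ∀ i, y i ^ p = φ (b i)) {ψ : K →+* K} {u : K}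
    (hψ : ∀ c : Fin p → K, ∑ j, ψ (c j) * u ^ j.val = 0 → c = 0) {a' b' e : Fin m → K} {α : K}
    (hα : α ≠ 0) (hαu : ψ α = u ^ p) (ha : ∀ i, ψ (a' i) = a i + (e i ^ p - e i))
    (hb : ∀ i, ψ (b' i) = b i) :
    IsDivisionSymbolTensor (HahnSeries ℤ K) p
      (Fin.snoc (fun i => HahnSeries.C (a' i)) (HahnSeries.single (-1) 1) :
        Fin (m + 1) → HahnSeries ℤ K)
      (Fin.snoc (fun i => HahnSeries.C (b' i)) (HahnSeries.C α) :
        Fin (m + 1) → HahnSeries ℤ K) := by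
  let _ : Algebra K S := (φ.comp ψ).toAlgebra' fun r s => hφ _ s
  have halg : ∀ r, algebraMap K S r = φ (ψ r) := fun r => rfl
  have : CharP S p := charP_of_injective_ringHom φ.injective p
  have hxy' := hxy.add_central (fun i => φ (e i)) fun i => hφ (e i)
  refine isDivisionAlgebra_laurent_step hp hα hxy' (fun i => ?_) (fun i => ?_) (u := φ u)
    (fun i => hφ _ _) (fun i => hφ _ _) ?_ ?_
  · have : Fact p.Prime := ⟨hp⟩
    rw [halg, ha, map_add, ← hx, add_pow_char_of_commute _ (hφ _ _).symm, map_sub, map_pow]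
    abel
  · rw [halg, hb, hy]
  · rw [halg, hαu, map_pow]
  · intro c hc
    ext1 J
    refine hψ (c J) (φ.injective ?_)
    rw [map_zero]
    refine congrFun (hxy'.eq_zero_of_sum_eq_zero hp
      (fun J => φ (∑ j, ψ (c J j) * u ^ j.val)) (fun J i => hφ _ _) (fun J i => hφ _ _) ?_) J
    rw [← hc, Finset.sum_comm]
    refine Finset.sum_congr rfl fun J _ => ?_
    rw [map_sum, Finset.sum_mul]
    refine Finset.sum_congr rfl fun j _ => ?_
    rw [Algebra.smul_def, halg, map_mul, ← map_pow, mul_assoc, (hφ (u ^ j.val) _).eq]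

theorem IsDivisionSymbolTensor.laurent {K : Type} [Field K] {p : ℕ} (hp : p.Prime) [CharP K p]
    {m : ℕ} {a b : Fin m → K} (h : IsDivisionSymbolTensor K p a b) (hb0 : ∀ i, b i ≠ 0)
    {ψ : K →+* K} {u : K}
    (hψ : ∀ c : Fin p → K, ∑ j, ψ (c j) * u ^ j.val = 0 → c = 0) {a' b' e : Fin m → K} {α : K}
    (hα : α ≠ 0) (hαu : ψ α = u ^ p) (ha : ∀ i, ψ (a' i) = a i + (e i ^ p - e i))
    (hb : ∀ i, ψ (b' i) = b i) :
    IsDivisionSymbolTensor (HahnSeries ℤ K) p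
      (Fin.snoc (fun i => HahnSeries.C (a' i)) (HahnSeries.single (-1) 1) :
        Fin (m + 1) → HahnSeries ℤ K)
      (Fin.snoc (fun i => HahnSeries.C (b' i)) (HahnSeries.C α) :
        Fin (m + 1) → HahnSeries ℤ K) := by
  obtain ⟨hnt, hunit⟩ := h
  have : NoZeroDivisors (⨂[K] i, ASSymbol K p (a i) (b i)) := ⟨fun {v w} hvw => by
    by_contra! h
    exact h.2 ((hunit v h.1).mul_right_eq_zero.1 hvw)⟩
  let ι : ∀ i, ASSymbol K p (a i) (b i) →ₐ[K] ⨂[K] i, ASSymbol K p (a i) (b i) :=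
    fun i => PiTensorProduct.singleAlgHom (R := K) (A := fun i => ASSymbol K p (a i) (b i)) i
  have hcomm : ∀ i j, i ≠ j → ∀ z w, Commute (ι i z) (ι j w) := by
    intro i j hij z w
    exact Commute.tprod (Pi.mulSingle_commute (f := fun i => ASSymbol K p (a i) (b i)) hij z w)
  have hy : ∀ i, ι i (ASSymbol.y K p (a i) (b i)) ^ p = algebraMap K _ (b i) := fun i => by
    rw [← map_pow, ASSymbol.y_pow, AlgHom.commutes]
  have hxy : SymbolCommRel (fun i => ι i (ASSymbol.x K p (a i) (b i)))
      (fun i => ι i (ASSymbol.y K p (a i) (b i))) :=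
    { mul_eq := fun i => by rw [← map_mul, ASSymbol.y_mul_x, map_mul, map_add, map_one]
      isUnit := fun i => by
        rw [← isUnit_pow_iff hp.ne_zero, hy]
        exact (isUnit_iff_ne_zero.2 (hb0 i)).map _
      commute_xx := fun i j hij => hcomm i j hij _ _
      commute_yy := fun i j hij => hcomm i j hij _ _
      commute_xy := fun i j hij => hcomm i j hij _ _ }
  exact hxy.isDivisionSymbolTensor_laurent hp (φ := algebraMap K _)
    (fun r s => Algebra.commute_algebraMap_left r s)
    (fun i => by rw [← map_pow, ← map_sub, ASSymbol.x_pow_sub, AlgHom.commutes]) hy hψ hα hαu ha hb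

/-- The substitution `t ↦ t ^ p` on Laurent series, over which `1, t, …, t ^ (p - 1)` are
independent. -/
theorem exists_laurent_expand (K : Type*) [Field K] {p : ℕ} (hp : 0 < p) :
    ∃ ψ : HahnSeries ℤ K →+* HahnSeries ℤ K, (∀ a, ψ (HahnSeries.C a) = HahnSeries.C a) ∧
      ψ (HahnSeries.single 1 1) = HahnSeries.single 1 1 ^ p ∧
      ∀ c : Fin p → HahnSeries ℤ K,
        ∑ j, ψ (c j) * HahnSeries.single 1 1 ^ j.val = 0 → c = 0 := by
  have hpos : (0 : ℤ) < p := by exact_mod_cast hp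
  have hinj : Function.Injective (AddMonoidHom.mulLeft (p : ℤ)) :=
    mul_right_injective₀ hpos.ne'
  have hle : ∀ n n' : ℤ, AddMonoidHom.mulLeft (p : ℤ) n ≤ AddMonoidHom.mulLeft (p : ℤ) n' ↔
      n ≤ n' := fun n n' => mul_le_mul_iff_right₀ hpos
  let ψ : HahnSeries ℤ K →+* HahnSeries ℤ K := HahnSeries.embDomainRingHom _ hinj hle
  have hpow : ∀ n : ℕ, (HahnSeries.single 1 1 : HahnSeries ℤ K) ^ n = HahnSeries.single (n : ℤ) 1 :=
    fun n => by rw [HahnSeries.single_pow]; simp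
  have hψ : ∀ (f : HahnSeries ℤ K) (n : ℤ), (ψ f).coeff (p * n) = f.coeff n := fun f n =>
    HahnSeries.embDomain_coeff (f := ⟨⟨_, hinj⟩, hle _ _⟩)
  refine ⟨ψ, fun a => HahnSeries.embDomainRingHom_C, ?_, fun c hc => ?_⟩
  · rw [hpow]
    refine HahnSeries.embDomain_single.trans ?_
    simp
  · ext j N
    have := congrArg (fun f : HahnSeries ℤ K => f.coeff (p * N + j.val)) hc
    simp only [HahnSeries.coeff_sum, HahnSeries.coeff_zero] at this
    rw [Finset.sum_eq_single j] at this
    · rwa [hpow, HahnSeries.coeff_mul_single_add, mul_one, hψ] at this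
    · intro i _ hij
      rw [hpow, show (p * N + j.val : ℤ) = (p * N + j.val - i.val) + i.val by ring,
        HahnSeries.coeff_mul_single_add, mul_one]
      refine HahnSeries.embDomain_of_notMem_range ?_
      rintro ⟨n, hn⟩
      change (p : ℤ) * n = _ at hn
      exact hij (mul_sub_eq_mul_sub_iff (p := p) (N := n) (N' := N) (a := j) (a' := i)
        |>.1 (by linarith)).2.symm
    · simp

namespace IterLaurent

theorem charP (k : Type) [Field k] (p : ℕ) [CharP k p] (n : ℕ) : CharP (IterLaurent k n) p := by
  induction n with
  | zero => exact (inferInstance : CharP k p)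
  | succ n ih =>
    have : CharP (HahnSeries ℤ (IterLaurent k n)) p :=
      charP_of_injective_ringHom (f := (HahnSeries.C : IterLaurent k n →+* _))
        HahnSeries.C_injective p
    exact this

theorem var_last (k : Type) [Field k] (n : ℕ) :
    var k (n + 1) (Fin.last n) = (HahnSeries.single 1 1 : HahnSeries ℤ (IterLaurent k n)) :=
  Fin.lastCases_last ..

theorem var_castSucc (k : Type) [Field k] (n : ℕ) (i : Fin n) :
    var k (n + 1) i.castSucc =
      (HahnSeries.C (var k n i) : HahnSeries ℤ (IterLaurent k n)) :=
  Fin.lastCases_castSucc ..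

theorem var_ne_zero (k : Type) [Field k] (n : ℕ) (i : Fin n) : var k n i ≠ 0 := by
  induction n with
  | zero => exact i.elim0
  | succ n ih =>
    induction i using Fin.lastCases with
    | last =>
      rw [var_last]
      exact HahnSeries.single_ne_zero one_ne_zero
    | cast i =>
      rw [var_castSucc]
      exact (map_ne_zero_iff _ HahnSeries.C_injective).2 (ih i)

theorem exists_expand (k : Type) [Field k] {p : ℕ} (hp : 0 < p) (n : ℕ) :
    ∃ ψ : IterLaurent k (n + 1) →+* IterLaurent k (n + 1),
      (∀ i : Fin n, ψ (var k (n + 1) i.castSucc) = var k (n + 1) i.castSucc) ∧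
      ψ (var k (n + 1) (Fin.last n)) = var k (n + 1) (Fin.last n) ^ p ∧
      ∀ c : Fin p → IterLaurent k (n + 1),
        ∑ j, ψ (c j) * var k (n + 1) (Fin.last n) ^ j.val = 0 → c = 0 := by
  simp only [var_last, var_castSucc]
  obtain ⟨ψ, hC, ht, hψ⟩ := exists_laurent_expand (IterLaurent k n) hp
  exact ⟨ψ, fun i => hC _, ht, hψ⟩

theorem isDivisionSymbolTensor {p : ℕ} (hp : p.Prime) (k : Type) [Field k] [CharP k p] (m : ℕ) :
    IsDivisionSymbolTensor (IterLaurent k (m + 1)) p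
      (fun i : Fin m => (var k (m + 1) i.succ)⁻¹) fun i : Fin m => var k (m + 1) i.castSucc := by
  induction m with
  | zero =>
    refine isDivisionAlgebra_piTensorProduct hp _ _ (R := IterLaurent k 1) Fin.elim0 Fin.elim0
      ⟨fun i => i.elim0, fun i => i.elim0, fun i => i.elim0, fun i => i.elim0, fun i => i.elim0⟩
      (fun i => i.elim0) (fun i => i.elim0) fun c hc w hw => ?_
    rw [Fintype.sum_unique] at hw
    refine (mul_eq_zero.1 hw).resolve_left fun h => hc ?_
    ext1 J
    rw [Subsingleton.elim J default]
    simpa [symbolMonomial] using h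
  | succ m ih =>
    have : CharP (IterLaurent k (m + 1)) p := charP k p (m + 1)
    obtain ⟨ψ, hψ, hψt, hc⟩ := exists_expand k hp.pos m
    have h := IsDivisionSymbolTensor.laurent hp ih (fun i => var_ne_zero k _ _) hc
      (a' := fun i => (var k (m + 1) i.succ)⁻¹) (b' := fun i => var k (m + 1) i.castSucc)
      (e := fun i => if i.succ = Fin.last m then (var k (m + 1) (Fin.last m))⁻¹ else 0)
      (var_ne_zero k _ (Fin.last m)) hψt (fun i => by
        split_ifs with hi
        · rw [hi, map_inv₀, hψt, inv_pow]
          ring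
        · obtain ⟨j, hj⟩ := Fin.exists_castSucc_eq.2 hi
          rw [← hj, map_inv₀, hψ, zero_pow hp.ne_zero, sub_zero, add_zero]) (fun i => hψ i)
    have ha : (fun i : Fin (m + 1) => (var k (m + 2) i.succ)⁻¹) =
        (Fin.snoc (fun i => HahnSeries.C ((var k (m + 1) i.succ)⁻¹)) (HahnSeries.single (-1) 1) :
          Fin (m + 1) → HahnSeries ℤ (IterLaurent k (m + 1))) := by
      ext1 i
      induction i using Fin.lastCases with
      | last =>
        rw [Fin.succ_last, var_last, Fin.snoc_last]
        refine (HahnSeries.inv_single (R := IterLaurent k (m + 1)) (1 : ℤ) 1).trans ?_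
        rw [inv_one]
      | cast i =>
        rw [Fin.succ_castSucc, var_castSucc, Fin.snoc_castSucc]
        exact (map_inv₀ (HahnSeries.C : _ →+* HahnSeries ℤ (IterLaurent k (m + 1))) _).symm
    have hb : (fun i : Fin (m + 1) => var k (m + 2) i.castSucc) =
        (Fin.snoc (fun i => HahnSeries.C (var k (m + 1) i.castSucc))
          (HahnSeries.C (var k (m + 1) (Fin.last m))) :
          Fin (m + 1) → HahnSeries ℤ (IterLaurent k (m + 1))) := by
      ext1 i
      induction i using Fin.lastCases with
      | last => rw [var_castSucc, Fin.snoc_last]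
      | cast i => rw [var_castSucc, Fin.snoc_castSucc]
    rw [ha, hb]
    exact h

end IterLaurent

/-- Let `p` be prime, `k` a field of characteristic `p`, `n = m+1 ≥ 2`, and
`F = k((α₁))…((αₙ))`. Then `[α₂⁻¹,α₁)_{p,F} ⊗ [α₃⁻¹,α₂)_{p,F} ⊗ ⋯ ⊗ [αₙ⁻¹,α_{n-1})_{p,F}`
is a division algebra over `F`. -/
theorem iterLaurent_tensor_symbols_isDivision (p : ℕ) (hp : p.Prime) (k : Type) [Field k]
    [CharP k p] (m : ℕ) (hm : 1 ≤ m) :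
    IsDivisionAlgebra (⨂[IterLaurent k (m + 1)] (i : Fin m),
      ASSymbol (IterLaurent k (m + 1)) p
        (IterLaurent.var k (m + 1) i.succ)⁻¹
        (IterLaurent.var k (m + 1) i.castSucc)) :=
  IterLaurent.isDivisionSymbolTensor hp k m
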